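/- Let U, V ∈ F(ε)^{r×n} both have full row rank, and suppose that for every size-r subset S ⊆ [n], lim_{ε→0} det(U_S)·det(V_S) exists. Then there exist matrices Ũ, Ṽ ∈ F(ε)^{r×n} such that for every size-r subset S ⊆ [n], both lim_{ε→0} det(Ũ_S) and lim_{ε→0} det(Ṽ_S) exist and lim_{ε→0} det(U_S)·det(V_S) = (lim_{ε→0} det(Ũ_S))·(lim_{ε→0} det(Ṽ_S)). -/

import Mathlib

open Polynomial Matrix
open scoped Classical

/-- The ε-adic valuation on F(ε): `val(g/h) = mindeg g - mindeg h` for nonzero elements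
(`mindeg p = rootMultiplicity 0 p`), and `val 0 = +∞`. -/
noncomputable def rfval {F : Type*} [Field F] (f : RatFunc F) : WithTop ℤ :=
  if f = 0 then ⊤
  else (((f.num.rootMultiplicity 0 : ℤ) - (f.denom.rootMultiplicity 0 : ℤ) : ℤ) : WithTop ℤ)

/-- `lim_{ε→0} f` exists iff `f` has no pole at ε = 0, i.e. val(f) ≥ 0. -/
def rfHasLim {F : Type*} [Field F] (f : RatFunc F) : Prop := 0 ≤ rfval f

/-- The value of `f` at ε = 0 (the limit of `f` at 0, when it exists). -/
noncomputable def rfLim {F : Type*} [Field F] (f : RatFunc F) : F :=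
  f.eval (RingHom.id F) 0

/-- The submatrix of `U` consisting of the columns indexed by a size-`r` subset `S` of `[n]`
(taken in increasing order). -/
def colSub {α : Type*} {r n : ℕ} (U : Matrix (Fin r) (Fin n) α)
    (S : {S : Finset (Fin n) // S.card = r}) : Matrix (Fin r) (Fin r) α :=
  U.submatrix id (fun j : Fin r => (S.1.orderIsoOfFin S.2 j : Fin n))


inductive WalkR {N : Type*} (R : N → N → ℤ → Prop) : N → N → ℕ → ℤ → Prop
  | nil (a : N) : WalkR R a a 0 0
  | snoc {a b d : N} {k : ℕ} {c c' : ℤ} :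
      WalkR R a b k c → R b d c' → WalkR R a d (k + 1) (c + c')

theorem WalkR.trans {N : Type*} {R : N → N → ℤ → Prop} {a b d : N} {k l : ℕ} {c c' : ℤ}
    (h : WalkR R a b k c) (h' : WalkR R b d l c') : WalkR R a d (k + l) (c + c') := by
  induction h' with
  | nil => simpa using h
  | snoc h1 h2 ih =>
    have := WalkR.snoc ih h2
    rwa [add_assoc, add_assoc] at this

theorem int_between (L M : Set ℤ) (hL : BddAbove L) (hM : BddBelow M)
    (h : ∀ l ∈ L, ∀ u ∈ M, l ≤ u) : ∃ x : ℤ, (∀ l ∈ L, l ≤ x) ∧ ∀ u ∈ M, x ≤ u := by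
  by_cases hn : M.Nonempty
  · exact ⟨sInf M, fun l hl => le_csInf hn (h l hl), fun u hu => csInf_le hM hu⟩
  · obtain ⟨x, hx⟩ := hL
    exact ⟨x, fun l hl => hx hl, fun u hu => (hn ⟨u, hu⟩).elim⟩

theorem potential_aux {N : Type*} (T : Finset N) : ∀ (R : N → N → ℤ → Prop),
    (∀ a b, BddBelow {c | R a b c}) → (∀ a k c, WalkR R a a k c → 0 ≤ c) →
    ∃ p : N → ℤ, ∀ a ∈ T, ∀ b ∈ T, ∀ c, R a b c → p b ≤ p a + c := by
  induction T using Finset.induction_on with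
  | empty => intro R _ _; exact ⟨fun _ => 0, by simp⟩
  | insert z T hz ih =>
    intro R hb hw
    obtain ⟨p, hp⟩ := ih
      (fun e f c => R e f c ∨ ∃ c1 c2, R e z c1 ∧ R z f c2 ∧ c = c1 + c2) (by
        intro a b
        obtain ⟨m, hm⟩ := hb a b
        obtain ⟨m1, hm1⟩ := hb a z
        obtain ⟨m2, hm2⟩ := hb z b
        refine ⟨min m (m1 + m2), ?_⟩
        rintro c (h | ⟨c1, c2, h1, h2, rfl⟩)
        · exact (min_le_left _ _).trans (hm h)
        · exact (min_le_right _ _).trans (add_le_add (hm1 h1) (hm2 h2))) (by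
        have key : ∀ a b k c, WalkR (fun e f c => R e f c ∨
            ∃ c1 c2, R e z c1 ∧ R z f c2 ∧ c = c1 + c2) a b k c → ∃ k', WalkR R a b k' c := by
          intro a b k c h
          induction h with
          | nil => exact ⟨0, .nil _⟩
          | snoc h1 h2 ih =>
            obtain ⟨k', hk⟩ := ih
            rcases h2 with h2 | ⟨c1, c2, h3, h4, rfl⟩
            · exact ⟨_, hk.snoc h2⟩
            · have := (hk.snoc h3).snoc h4
              rw [add_assoc _ c1 c2] at this
              exact ⟨_, this⟩
        intro a k c h
        obtain ⟨k', h'⟩ := key a a k c h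
        exact hw _ _ _ h')
    obtain ⟨x, hx1, hx2⟩ := int_between {l | ∃ f ∈ T, ∃ c, R z f c ∧ l = p f - c}
      {u | ∃ e ∈ T, ∃ c, R e z c ∧ u = p e + c} (by
        have : {l | ∃ f ∈ T, ∃ c, R z f c ∧ l = p f - c} =
          ⋃ f ∈ (T : Set N), {l | ∃ c, R z f c ∧ l = p f - c} := by ext; simp
        rw [this, Set.Finite.bddAbove_biUnion T.finite_toSet]
        intro f hf
        obtain ⟨m, hm⟩ := hb z f
        refine ⟨p f - m, ?_⟩
        rintro _ ⟨c, hc, rfl⟩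
        have := hm hc
        omega) (by
        have : {u | ∃ e ∈ T, ∃ c, R e z c ∧ u = p e + c} =
          ⋃ f ∈ (T : Set N), {u | ∃ c, R f z c ∧ u = p f + c} := by ext; simp
        rw [this, Set.Finite.bddBelow_biUnion T.finite_toSet]
        intro f hf
        obtain ⟨m, hm⟩ := hb f z
        refine ⟨p f + m, ?_⟩
        rintro _ ⟨c, hc, rfl⟩
        have := hm hc
        omega) (by
        rintro _ ⟨f, hf, c, hc, rfl⟩ _ ⟨e, he, c', hc', rfl⟩
        have := hp e he f hf _ (Or.inr ⟨c', c, hc', hc, rfl⟩)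
        omega)
    refine ⟨Function.update p z x, ?_⟩
    intro a ha b hb' c hc
    have hne : ∀ y ∈ T, y ≠ z := fun y hy h => hz (h ▸ hy)
    rcases Finset.mem_insert.1 ha with rfl | ha1
    · rcases Finset.mem_insert.1 hb' with rfl | hb1
      · have := hw _ _ _ ((WalkR.nil b).snoc hc)
        omega
      · rw [Function.update_self, Function.update_of_ne (hne _ hb1)]
        have := hx1 _ ⟨b, hb1, c, hc, rfl⟩
        omega
    · rcases Finset.mem_insert.1 hb' with rfl | hb1
      · rw [Function.update_self, Function.update_of_ne (hne _ ha1)]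
        exact hx2 _ ⟨a, ha1, c, hc, rfl⟩
      · rw [Function.update_of_ne (hne _ hb1), Function.update_of_ne (hne _ ha1)]
        exact hp a ha1 b hb1 c (Or.inl hc)

theorem WalkR.exists_fun {N : Type*} {R : N → N → ℤ → Prop} {a b : N} {k : ℕ} {c : ℤ}
    (h : WalkR R a b k c) : ∃ (f : ℕ → N) (w : ℕ → ℤ), f 0 = a ∧ f k = b ∧
      (∀ t < k, R (f t) (f (t + 1)) (w t)) ∧ c = ∑ t ∈ Finset.range k, w t := by
  induction h with
  | nil => exact ⟨fun _ => a, fun _ => 0, rfl, rfl, by simp, by simp⟩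
  | @snoc b d k c c' h1 h2 ih =>
    obtain ⟨f, w, h0, hk, hR, hc⟩ := ih
    refine ⟨Function.update f (k + 1) d, Function.update w k c', ?_, ?_, ?_, ?_⟩
    · rw [Function.update_of_ne (by omega), h0]
    · simp
    · intro t ht
      rw [Function.update_of_ne (by omega : t ≠ k + 1)]
      by_cases htk : t = k
      · subst htk
        simpa [hk] using h2
      · rw [Function.update_of_ne (by omega), Function.update_of_ne htk]
        exact hR t (by omega)
    · rw [Finset.sum_range_succ, Function.update_self, hc]
      congr 1
      apply Finset.sum_congr rfl
      intro t ht
      rw [Function.update_of_ne (by have := Finset.mem_range.1 ht; omega)]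

theorem walk_of_fun {N : Type*} {R : N → N → ℤ → Prop} (f : ℕ → N) (w : ℕ → ℤ) (k : ℕ)
    (hR : ∀ t < k, R (f t) (f (t + 1)) (w t)) (s d : ℕ) (h : s + d ≤ k) :
    WalkR R (f s) (f (s + d)) d
      (∑ t ∈ Finset.range (s + d), w t - ∑ t ∈ Finset.range s, w t) := by
  induction d with
  | zero => simpa using WalkR.nil (f s)
  | succ d ih =>
    have := (ih (by omega)).snoc (hR (s + d) (by omega))
    rw [← add_assoc s d 1, Finset.sum_range_succ]
    convert this using 1
    ring

/-- A matrix whose entries have strictly triangular-dominated valuations. -/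
theorem val_det_eq {K : Type*} [Field K] (v : AddValuation K (WithTop ℤ)) {k : ℕ}
    (M : Matrix (Fin k) (Fin k) K) (P Q : Fin k → ℤ)
    (hd : ∀ i, v (M i i) = ((Q i - P i : ℤ) : WithTop ℤ))
    (hge : ∀ i j, ((Q j - P i : ℤ) : WithTop ℤ) ≤ v (M i j))
    (hgt : ∀ σ : Equiv.Perm (Fin k), σ ≠ 1 → ∃ j,
      ((Q j - P (σ j) : ℤ) : WithTop ℤ) < v (M (σ j) j)) :
    v M.det = ((∑ i, Q i - ∑ i, P i : ℤ) : WithTop ℤ) := by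
  have hprod : ∀ σ : Equiv.Perm (Fin k), v (Equiv.Perm.sign σ • ∏ i, M (σ i) i) =
      ∑ i, v (M (σ i) i) := by
    intro σ
    have h1 : v (∏ i, M (σ i) i) = ∑ i, v (M (σ i) i) := by
      induction (Finset.univ : Finset (Fin k)) using Finset.induction_on with
      | empty => simp
      | insert a s ha ih => rw [Finset.prod_insert ha, Finset.sum_insert ha, v.map_mul, ih]
    rw [← h1]
    rcases Int.units_eq_one_or (Equiv.Perm.sign σ) with h | h <;> simp [h]
  have hsum : ∀ σ : Equiv.Perm (Fin k), ((∑ i, Q i - ∑ i, P i : ℤ) : WithTop ℤ) =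
      ∑ j, ((Q j - P (σ j) : ℤ) : WithTop ℤ) := by
    intro σ
    rw [← Equiv.sum_comp σ P, ← Finset.sum_sub_distrib, WithTop.coe_sum]
  have hlt : ∀ σ : Equiv.Perm (Fin k), σ ≠ 1 → ((∑ i, Q i - ∑ i, P i : ℤ) : WithTop ℤ) <
      v (Equiv.Perm.sign σ • ∏ i, M (σ i) i) := by
    intro σ hσ
    rw [hprod]
    by_cases ht : ∃ j, v (M (σ j) j) = ⊤
    · obtain ⟨j, hj⟩ := ht
      rw [WithTop.sum_eq_top.2 ⟨j, Finset.mem_univ _, hj⟩]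
      exact WithTop.coe_lt_top _
    · push Not at ht
      have : ∀ j, ∃ z : ℤ, v (M (σ j) j) = z := fun j => ⟨_, (WithTop.coe_untop _ (ht j)).symm⟩
      choose z hz using this
      simp only [hz]
      rw [← WithTop.coe_sum, WithTop.coe_lt_coe, ← Equiv.sum_comp σ P, ← Finset.sum_sub_distrib]
      apply Finset.sum_lt_sum
      · intro j _
        have := hge (σ j) j
        rw [hz] at this
        exact WithTop.coe_le_coe.1 this
      · obtain ⟨j, hj⟩ := hgt σ hσ
        rw [hz] at hj
        exact ⟨j, Finset.mem_univ _, WithTop.coe_lt_coe.1 hj⟩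
  have h1 : v (Equiv.Perm.sign (1 : Equiv.Perm (Fin k)) • ∏ i, M ((1 : Equiv.Perm (Fin k)) i) i) =
      ((∑ i, Q i - ∑ i, P i : ℤ) : WithTop ℤ) := by
    rw [hprod, hsum 1]
    exact Finset.sum_congr rfl fun i _ => hd i
  rw [Matrix.det_apply, ← Finset.add_sum_erase _ _ (Finset.mem_univ (1 : Equiv.Perm (Fin k)))]
  rw [AddValuation.map_add_eq_of_lt_left, h1]
  rw [h1]
  apply AddValuation.map_lt_sum
  · exact WithTop.coe_ne_top
  · intro σ hσ
    exact hlt σ (Finset.ne_of_mem_erase hσ)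

theorem perm_exists_lt {k : ℕ} (σ : Equiv.Perm (Fin k)) (h : σ ≠ 1) : ∃ j, σ j < j := by
  by_contra hc
  push Not at hc
  apply h
  have hs : ∑ j, ((σ j : ℕ)) = ∑ j : Fin k, (j : ℕ) := Equiv.sum_comp σ (fun j : Fin k => (j : ℕ))
  have := (Finset.sum_eq_sum_iff_of_le (s := Finset.univ) (f := fun j : Fin k => (j : ℕ))
    (g := fun j => ((σ j : ℕ))) (fun j _ => Fin.le_def.1 (hc j))).1 hs.symm
  ext j
  exact (this j (Finset.mem_univ _)).symm

theorem perm_exists_gt {k : ℕ} (σ : Equiv.Perm (Fin k)) (h : σ ≠ 1) : ∃ j, j < σ j := by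
  obtain ⟨j, hj⟩ := perm_exists_lt σ⁻¹ (by simpa using h)
  exact ⟨σ⁻¹ j, by simpa using hj⟩

def arcR {K I J : Type*} [Field K] (v : AddValuation K (WithTop ℤ)) (A B : Matrix I J K)
    (i i' : I) (c : ℤ) : Prop :=
  ∃ (j : J) (a b : ℤ), v (A i j) = (a : WithTop ℤ) ∧ v (B i' j) = (b : WithTop ℤ) ∧ c = a + b

theorem closed_walk_nonneg {K I J : Type*} [Field K] (v : AddValuation K (WithTop ℤ))
    (A B : Matrix I J K)
    (h : ∀ (k : ℕ) (f : Fin k → I) (g : Fin k → J),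
      0 ≤ v ((A.submatrix f g).det * (B.submatrix f g).det)) (k : ℕ) :
    ∀ a c, WalkR (arcR v A B) a a k c → 0 ≤ c := by
  induction k using Nat.strong_induction_on with
  | _ k ih =>
  intro a0 c0 hw
  by_contra hneg
  push Not at hneg
  obtain ⟨f, w, hf0, hfk, hR, hc⟩ := hw.exists_fun
  have hk0 : k ≠ 0 := by
    rintro rfl
    simp at hc
    omega
  have hR' : ∀ t : Fin k, arcR v A B (f t) (f (t + 1)) (w t) := fun t => hR t t.2
  choose j a b ha hb hab using hR'
  have hsub := walk_of_fun f w k hR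
  set P : ℕ → ℤ := fun t => ∑ s ∈ Finset.range t, w s with hP
  have hP0 : P 0 = 0 := by simp [hP]
  have hPk : P k = c0 := hc.symm
  have hPs : ∀ t, P (t + 1) = P t + w t := fun t => Finset.sum_range_succ _ _
  -- general closed-walk inequalities
  have walk1 : ∀ s t : ℕ, s ≤ t → t + 1 - s < k → t ≤ k → ∀ c, arcR v A B (f t) (f s) c →
      0 ≤ P t - P s + c := by
    intro s t hst hlt htk c hc'
    have h1 := hsub s (t - s) (by omega)
    rw [show s + (t - s) = t by omega] at h1
    exact ih _ (by omega) _ _ (h1.snoc hc')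
  have walk2 : ∀ s t : ℕ, s ≤ k → k - s + t + 1 < k → ∀ c, arcR v A B (f t) (f s) c →
      0 ≤ c0 - P s + P t + c := by
    intro s t hsk hlt c hc'
    have h1 := hsub s (k - s) (by omega)
    rw [show s + (k - s) = k by omega, hfk, ← hf0] at h1
    have h2 := hsub 0 t (by omega)
    rw [zero_add] at h2
    have := ih _ (by omega) _ _ ((h1.trans h2).snoc hc')
    change 0 ≤ P k - P s + (P t - P 0) + c at this
    omega
  have hAge : ∀ l m : Fin k, m < l → ∀ z : ℤ, v (A (f l) (j m)) = z →
      P m + a m - P l ≤ z := by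
    intro l m hml z hz
    have hml' : (m : ℕ) < l := hml
    have := walk1 (m + 1) l (by omega) (by omega) (by omega) (z + b m)
      ⟨j m, z, b m, hz, hb m, rfl⟩
    have := hPs m
    have := hab m
    omega
  have hAgt : ∀ l m : Fin k, l < m → ∀ z : ℤ, v (A (f l) (j m)) = z →
      P m + a m - P l < z := by
    intro l m hml z hz
    have hml' : (l : ℕ) < m := hml
    have := walk2 (m + 1) l (by omega) (by omega) (z + b m) ⟨j m, z, b m, hz, hb m, rfl⟩
    have := hPs m
    have := hab m
    omega
  have hBge : ∀ l m : Fin k, l < m → ∀ z : ℤ, v (B (f (l + 1)) (j m)) = z →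
      P (l + 1) - (P m + a m) ≤ z := by
    intro l m hml z hz
    have hml' : (l : ℕ) < m := hml
    have := walk1 (l + 1) m (by omega) (by omega) (by omega) (a m + z)
      ⟨j m, a m, z, ha m, hz, rfl⟩
    omega
  have hBgt : ∀ l m : Fin k, m < l → ∀ z : ℤ, v (B (f (l + 1)) (j m)) = z →
      P (l + 1) - (P m + a m) < z := by
    intro l m hml z hz
    have hml' : (m : ℕ) < l := hml
    have := walk2 (l + 1) m (by omega) (by omega) (a m + z) ⟨j m, a m, z, ha m, hz, rfl⟩
    omega
  have lift_le : ∀ (x : K) (y : ℤ), (∀ z : ℤ, v x = z → y ≤ z) → (y : WithTop ℤ) ≤ v x := by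
    intro x y hh
    rcases hx : v x with _ | z
    · exact le_top
    · exact WithTop.coe_le_coe.2 (hh z hx)
  have lift_lt : ∀ (x : K) (y : ℤ), (∀ z : ℤ, v x = z → y < z) → (y : WithTop ℤ) < v x := by
    intro x y hh
    rcases hx : v x with _ | z
    · exact WithTop.coe_lt_top _
    · exact WithTop.coe_lt_coe.2 (hh z hx)
  have hdA : v (A.submatrix (fun l : Fin k => f l) j).det =
      ((∑ i : Fin k, (P i + a i) - ∑ i : Fin k, P i : ℤ) : WithTop ℤ) := by
    apply val_det_eq v _ (fun i => P i) (fun i => P i + a i)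
    · intro i
      simp [ha]
    · intro l m
      rcases lt_trichotomy l m with hlm | rfl | hlm
      · exact lift_le _ _ fun z hz => (hAgt l m hlm z hz).le
      · simp [ha]
      · exact lift_le _ _ fun z hz => (hAge l m hlm z hz)
    · intro σ hσ
      obtain ⟨m, hm⟩ := perm_exists_lt σ hσ
      exact ⟨m, lift_lt _ _ fun z hz => (hAgt _ m hm z hz)⟩
  have hdB : v (B.submatrix (fun l : Fin k => f (l + 1)) j).det =
      ((∑ i : Fin k, -(P i + a i) - ∑ i : Fin k, -P (i + 1) : ℤ) : WithTop ℤ) := by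
    apply val_det_eq v _ (fun i => -P (i + 1)) (fun i => -(P i + a i))
    · intro i
      rw [Matrix.submatrix_apply, hb]
      have := hPs i
      have := hab i
      congr 1
      omega
    · intro l m
      rcases lt_trichotomy l m with hlm | rfl | hlm
      · exact lift_le _ _ fun z hz => by have := (hBge l m hlm z hz); omega
      · rw [Matrix.submatrix_apply, hb]
        have := hPs l
        have := hab l
        apply WithTop.coe_le_coe.2
        omega
      · exact lift_le _ _ fun z hz => by have := (hBgt l m hlm z hz); omega
    · intro σ hσ
      obtain ⟨m, hm⟩ := perm_exists_gt σ hσ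
      exact ⟨m, lift_lt _ _ fun z hz => by have := (hBgt _ m hm z hz); omega⟩
  obtain ⟨k, rfl⟩ : ∃ k', k = k' + 1 := ⟨k - 1, by omega⟩
  have hrot : (fun l : Fin (k + 1) => f (l + 1)) = (fun l : Fin (k + 1) => f l) ∘ finRotate (k + 1) := by
    funext l
    simp only [Function.comp_apply]
    by_cases hl : l = Fin.last k
    · subst hl
      rw [finRotate_last]
      simpa [hf0] using hfk
    · rw [coe_finRotate_of_ne_last hl]
  have hperm : v (B.submatrix (fun l : Fin (k + 1) => f (l + 1)) j).det =
      v (B.submatrix (fun l : Fin (k + 1) => f l) j).det := by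
    rw [hrot]
    have := Matrix.det_permute (finRotate (k + 1)) (B.submatrix (fun l : Fin (k + 1) => f l) j)
    rw [Matrix.submatrix_submatrix] at this
    rw [Function.comp_id] at this
    rw [this]
    rcases Int.units_eq_one_or (Equiv.Perm.sign (finRotate (k + 1))) with h | h <;> rw [h] <;> simp
  have hfin := h (k + 1) (fun l => f l) j
  rw [v.map_mul, ← hperm, hdA, hdB, ← WithTop.coe_add] at hfin
  have hfin' : (0 : ℤ) ≤ _ := WithTop.coe_le_coe.1 hfin
  have e1 : ∑ i : Fin (k + 1), P (i + 1) - ∑ i : Fin (k + 1), P i = c0 := by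
    rw [← Finset.sum_sub_distrib]
    rw [Fin.sum_univ_eq_sum_range (fun i => P (i + 1) - P i) (k + 1), Finset.sum_range_sub]
    omega
  rw [Finset.sum_neg_distrib, Finset.sum_neg_distrib] at hfin'
  omega

/-- Existence of the splitting weights. -/
theorem exists_weights {K I J : Type*} [Field K] [Finite I] (v : AddValuation K (WithTop ℤ))
    (A B : Matrix I J K) [Finite J]
    (h : ∀ (k : ℕ) (f : Fin k → I) (g : Fin k → J),
      0 ≤ v ((A.submatrix f g).det * (B.submatrix f g).det)) :
    ∃ (x : I → ℤ) (y : J → ℤ), ∀ i j,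
      ((y j - x i : ℤ) : WithTop ℤ) ≤ v (A i j) ∧ ((x i - y j : ℤ) : WithTop ℤ) ≤ v (B i j) := by
  cases nonempty_fintype I
  have fin1 : ∀ x : K, {c : ℤ | v x = c}.Finite := by
    intro x
    apply Set.Subsingleton.finite
    intro c hc c' hc'
    exact WithTop.coe_injective (hc.symm.trans hc')
  obtain ⟨x, hx⟩ := potential_aux (Finset.univ : Finset I) (arcR v A B) (by
    intro i i'
    apply Set.Finite.bddBelow
    have : {c | arcR v A B i i' c} ⊆
        ⋃ j, Set.image2 (· + ·) {c : ℤ | v (A i j) = c} {c : ℤ | v (B i' j) = c} := by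
      rintro c ⟨j, a, b, ha, hb, rfl⟩
      exact Set.mem_iUnion.2 ⟨j, Set.mem_image2_of_mem ha hb⟩
    exact (Set.finite_iUnion fun j => (fin1 _).image2 _ (fin1 _)).subset this)
    (fun a k c => closed_walk_nonneg v A B h k a c)
  have : ∀ j, ∃ y : ℤ, (∀ l ∈ ⋃ i, (fun c => x i - c) '' {c : ℤ | v (B i j) = c}, l ≤ y) ∧
      ∀ u ∈ ⋃ i, (fun c => x i + c) '' {c : ℤ | v (A i j) = c}, y ≤ u := by
    intro j
    apply int_between
    · exact (Set.finite_iUnion fun i => (fin1 _).image _).bddAbove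
    · exact (Set.finite_iUnion fun i => (fin1 _).image _).bddBelow
    · intro l hl u hu
      obtain ⟨i', b, hb, rfl⟩ := Set.mem_iUnion.1 hl
      obtain ⟨i, a, ha, rfl⟩ := Set.mem_iUnion.1 hu
      have := hx i (Finset.mem_univ _) i' (Finset.mem_univ _) (a + b) ⟨j, a, b, ha, hb, rfl⟩
      dsimp only
      omega
  choose y hy1 hy2 using this
  refine ⟨x, y, fun i j => ⟨?_, ?_⟩⟩
  · rcases hz : v (A i j) with _ | z
    · exact le_top
    · apply WithTop.coe_le_coe.2
      have := hy2 j _ (Set.mem_iUnion.2 ⟨i, z, hz, rfl⟩)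
      dsimp only at this
      omega
  · rcases hz : v (B i j) with _ | z
    · exact le_top
    · apply WithTop.coe_le_coe.2
      have := hy1 j _ (Set.mem_iUnion.2 ⟨i, z, hz, rfl⟩)
      dsimp only at this
      omega

theorem rfval_zero {F : Type*} [Field F] : rfval (0 : RatFunc F) = ⊤ := by simp [rfval]

theorem rfval_one {F : Type*} [Field F] : rfval (1 : RatFunc F) = 0 := by
  have h : (1 : F[X]).rootMultiplicity 0 = 0 := by
    rw [← Polynomial.C_1, Polynomial.rootMultiplicity_C]
  rw [rfval, if_neg one_ne_zero]
  simp [h]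

theorem rfval_of_ne {F : Type*} [Field F] {f : RatFunc F} (h : f ≠ 0) :
    rfval f = (((f.num.rootMultiplicity 0 : ℤ) - (f.denom.rootMultiplicity 0 : ℤ) : ℤ) :
      WithTop ℤ) := if_neg h

theorem rfval_mul {F : Type*} [Field F] (f g : RatFunc F) :
    rfval (f * g) = rfval f + rfval g := by
  by_cases hf : f = 0
  · simp [hf, rfval_zero]
  by_cases hg : g = 0
  · simp [hg, rfval_zero]
  have hfg := mul_ne_zero hf hg
  rw [rfval_of_ne hf, rfval_of_ne hg, rfval_of_ne hfg, ← WithTop.coe_add]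
  have h := congrArg (Polynomial.rootMultiplicity 0) (RatFunc.num_denom_mul f g)
  have n1 := RatFunc.num_ne_zero hf
  have n2 := RatFunc.num_ne_zero hg
  have n3 := RatFunc.num_ne_zero hfg
  have d1 := RatFunc.denom_ne_zero f
  have d2 := RatFunc.denom_ne_zero g
  have d3 := RatFunc.denom_ne_zero (f * g)
  rw [Polynomial.rootMultiplicity_mul (mul_ne_zero n3 (mul_ne_zero d1 d2)),
    Polynomial.rootMultiplicity_mul (mul_ne_zero d1 d2),
    Polynomial.rootMultiplicity_mul (mul_ne_zero (mul_ne_zero n1 n2) d3),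
    Polynomial.rootMultiplicity_mul (mul_ne_zero n1 n2)] at h
  congr 1
  omega

theorem rfval_add {F : Type*} [Field F] (f g : RatFunc F) :
    min (rfval f) (rfval g) ≤ rfval (f + g) := by
  by_cases hf : f = 0
  · simp [hf, rfval_zero]
  by_cases hg : g = 0
  · simp [hg, rfval_zero]
  by_cases hfg : f + g = 0
  · simp [hfg, rfval_zero]
  rw [rfval_of_ne hf, rfval_of_ne hg, rfval_of_ne hfg, ← WithTop.coe_min]
  apply WithTop.coe_le_coe.2
  have n1 := RatFunc.num_ne_zero hf
  have n2 := RatFunc.num_ne_zero hg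
  have n3 := RatFunc.num_ne_zero hfg
  have d1 := RatFunc.denom_ne_zero f
  have d2 := RatFunc.denom_ne_zero g
  have d3 := RatFunc.denom_ne_zero (f + g)
  have h0 := RatFunc.num_denom_add f g
  have hne : f.num * g.denom + f.denom * g.num ≠ 0 := by
    intro h
    rw [h, zero_mul] at h0
    exact mul_ne_zero n3 (mul_ne_zero d1 d2) h0
  have h := congrArg (Polynomial.rootMultiplicity 0) h0
  have h2 := Polynomial.rootMultiplicity_add (a := (0 : F)) hne
  rw [Polynomial.rootMultiplicity_mul (mul_ne_zero n3 (mul_ne_zero d1 d2)),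
    Polynomial.rootMultiplicity_mul (mul_ne_zero d1 d2),
    Polynomial.rootMultiplicity_mul (mul_ne_zero hne d3)] at h
  rw [Polynomial.rootMultiplicity_mul (mul_ne_zero n1 d2),
    Polynomial.rootMultiplicity_mul (mul_ne_zero d1 n2)] at h2
  omega

noncomputable def rfAddVal (F : Type*) [Field F] : AddValuation (RatFunc F) (WithTop ℤ) :=
  AddValuation.of rfval rfval_zero rfval_one rfval_add rfval_mul

theorem rfAddVal_apply {F : Type*} [Field F] (f : RatFunc F) : rfAddVal F f = rfval f := rfl

theorem denom_eval_ne {F : Type*} [Field F] {f : RatFunc F} (h : rfHasLim f) :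
    Polynomial.eval₂ (RingHom.id F) 0 f.denom ≠ 0 := by
  by_cases hf : f = 0
  · simp [hf]
  intro hd
  unfold rfHasLim at h
  rw [rfval_of_ne hf] at h
  have h' : (0 : ℤ) ≤ _ := WithTop.coe_le_coe.1 h
  have hr : f.denom.IsRoot 0 := hd
  have h1 := (Polynomial.rootMultiplicity_pos (RatFunc.denom_ne_zero f)).2 hr
  have h2 : f.num.IsRoot 0 :=
    (Polynomial.rootMultiplicity_pos (RatFunc.num_ne_zero hf)).1 (by omega)
  obtain ⟨a, b, hab⟩ := RatFunc.isCoprime_num_denom f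
  have := congrArg (Polynomial.eval 0) hab
  simp [h2.eq_zero, hr.eq_zero] at this

theorem rfLim_mul {F : Type*} [Field F] {f g : RatFunc F} (hf : rfHasLim f) (hg : rfHasLim g) :
    rfLim (f * g) = rfLim f * rfLim g :=
  RatFunc.eval_mul _ _ (denom_eval_ne hf) (denom_eval_ne hg)

theorem rfLim_eq_zero {F : Type*} [Field F] {f : RatFunc F} (h : 0 < rfval f) : rfLim f = 0 := by
  by_cases hf : f = 0
  · simp [hf, rfLim]
  rw [rfval_of_ne hf] at h
  have h' : (0 : ℤ) < _ := WithTop.coe_lt_coe.1 h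
  have h2 : f.num.IsRoot 0 :=
    (Polynomial.rootMultiplicity_pos (RatFunc.num_ne_zero hf)).1 (by omega)
  have h3 : Polynomial.eval₂ (RingHom.id F) 0 f.num = 0 := h2
  rw [rfLim, RatFunc.eval, h3, zero_div]

theorem rfval_X_zpow {F : Type*} [Field F] (m : ℤ) :
    rfval ((RatFunc.X : RatFunc F) ^ m) = (m : WithTop ℤ) := by
  have hX : rfval (RatFunc.X : RatFunc F) = ((1 : ℤ) : WithTop ℤ) := by
    rw [rfval_of_ne RatFunc.X_ne_zero]
    have h1 : (Polynomial.X : F[X]).rootMultiplicity 0 = 1 := by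
      simpa using Polynomial.rootMultiplicity_X_sub_C_self (x := (0 : F))
    have h2 : (1 : F[X]).rootMultiplicity 0 = 0 := by
      rw [← Polynomial.C_1, Polynomial.rootMultiplicity_C]
    simp [h1, h2]
  have hn : ∀ n : ℕ, rfval ((RatFunc.X : RatFunc F) ^ n) = ((n : ℤ) : WithTop ℤ) := by
    intro n
    induction n with
    | zero => simp [rfval_one]
    | succ n ih =>
      rw [pow_succ, rfval_mul, ih, hX, ← WithTop.coe_add]
      congr 1
  rcases le_total 0 m with h | h
  · lift m to ℕ using h
    rw [zpow_natCast]
    exact hn m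
  · have hne : (RatFunc.X : RatFunc F) ^ m ≠ 0 := zpow_ne_zero _ RatFunc.X_ne_zero
    obtain ⟨n, hn'⟩ := Int.exists_eq_neg_ofNat h
    have h1 : (RatFunc.X : RatFunc F) ^ m * RatFunc.X ^ n = 1 := by
      rw [hn', ← zpow_natCast, ← zpow_add₀ RatFunc.X_ne_zero]
      simp
    have h2 := congrArg rfval h1
    rw [rfval_mul, hn, rfval_one, rfval_of_ne hne, ← WithTop.coe_add] at h2
    have h3 : _ = (0 : ℤ) := WithTop.coe_injective h2
    rw [rfval_of_ne hne]
    congr 1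
    omega

theorem val_det_nonneg {K : Type*} [Field K] (v : AddValuation K (WithTop ℤ)) {k : ℕ}
    (M : Matrix (Fin k) (Fin k) K) (h : ∀ i j, 0 ≤ v (M i j)) : 0 ≤ v M.det := by
  rw [Matrix.det_apply]
  apply AddValuation.map_le_sum
  intro σ _
  have h1 : 0 ≤ v (∏ i, M (σ i) i) := by
    induction (Finset.univ : Finset (Fin k)) using Finset.induction_on with
    | empty => simp
    | insert a s ha ih =>
      rw [Finset.prod_insert ha, v.map_mul]
      exact add_nonneg (h _ _) ih
  rcases Int.units_eq_one_or (Equiv.Perm.sign σ) with h | h <;> simpa [h] using h1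

/-- Passing from increasing column subsets to arbitrary column functions. -/
theorem cols_fun {K : Type*} [Field K] {r n : ℕ} (v : AddValuation K (WithTop ℤ))
    (A B : Matrix (Fin r) (Fin n) K)
    (h : ∀ S : {S : Finset (Fin n) // S.card = r}, 0 ≤ v ((colSub A S).det * (colSub B S).det))
    (c : Fin r → Fin n) : 0 ≤ v ((A.submatrix id c).det * (B.submatrix id c).det) := by
  by_cases hc : Function.Injective c
  · let S : {S : Finset (Fin n) // S.card = r} :=
      ⟨Finset.univ.image c, by rw [Finset.card_image_of_injective _ hc]; simp⟩
    let e : Fin r ≃ S.1 := (S.1.orderIsoOfFin S.2).toEquiv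
    have hmem : ∀ i, c i ∈ S.1 := fun i => Finset.mem_image_of_mem c (Finset.mem_univ i)
    let g : Fin r → Fin r := fun i => e.symm ⟨c i, hmem i⟩
    have hg : Function.Injective g := by
      intro i j hij
      have := e.symm.injective hij
      exact hc (Subtype.mk.inj this)
    let σ : Equiv.Perm (Fin r) := Equiv.ofBijective g (Finite.injective_iff_bijective.1 hg)
    have key : ∀ M : Matrix (Fin r) (Fin n) K, (M.submatrix id c).det =
        Equiv.Perm.sign σ * (colSub M S).det := by
      intro M
      rw [← Matrix.det_permute', colSub, Matrix.submatrix_submatrix]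
      congr 2
      funext i
      change c i = ((e (e.symm ⟨c i, hmem i⟩) : S.1) : Fin n)
      rw [Equiv.apply_symm_apply]
    rw [key, key]
    have := h S
    rcases Int.units_eq_one_or (Equiv.Perm.sign σ) with h | h <;> rw [h] <;> simpa using this
  · have : (A.submatrix id c).det = 0 := by
      simp only [Function.Injective, not_forall] at hc
      obtain ⟨i, j, hij, hne⟩ := hc
      exact Matrix.det_zero_of_column_eq hne (by intro k; simp [hij])
    rw [this, zero_mul, v.map_zero]
    exact le_top

/-- Minors of a matrix containing an identity block are maximal minors. -/
theorem minor_eq {K : Type*} [Field K] {r n k : ℕ} (A : Matrix (Fin r) (Fin n) K)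
    (s : Fin r → Fin n) (hs : A.submatrix id s = 1) (f : Fin k → Fin r)
    (hf : Function.Injective f) (g : Fin k → Fin n) :
    (A.submatrix f g).det = (A.submatrix id (fun i =>
      if h : ∃ l, f l = i then g h.choose else s i)).det := by
  have hs' : ∀ i j, A i (s j) = (1 : Matrix (Fin r) (Fin r) K) i j := fun i j => by rw [← hs]; rfl
  rw [Matrix.twoBlockTriangular_det' _ (fun i => ∃ l, f l = i)]
  · have h2 : (Matrix.toSquareBlockProp (A.submatrix id (fun i =>
      if h : ∃ l, f l = i then g h.choose else s i)) (fun i => ¬ ∃ l, f l = i)) = 1 := by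
      ext i j
      simp only [Matrix.toSquareBlockProp_def, Matrix.of_apply, Matrix.submatrix_apply, id,
        dif_neg j.2, hs', Matrix.one_apply, Subtype.ext_iff]
    rw [h2, Matrix.det_one, mul_one]
    let e : Fin k ≃ {i // ∃ l, f l = i} := Equiv.ofInjective f hf
    have he : ∀ l, ((e l : {i // ∃ l, f l = i}) : Fin r) = f l := fun l => rfl
    refine Eq.trans ?_ (Matrix.det_submatrix_equiv_self e _)
    congr 1
    ext i j
    have hj : ∃ l, f l = f j := ⟨j, rfl⟩
    have : hj.choose = j := hf hj.choose_spec
    simp only [Matrix.toSquareBlockProp_def, Matrix.submatrix_apply, Matrix.of_apply, id, he]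
    rw [dif_pos hj, this]
  · intro i hi j hj
    simp only [Matrix.submatrix_apply, id, dif_neg hj, hs']
    rw [Matrix.one_apply_ne]
    rintro rfl
    exact hj hi

theorem minors_nonneg {K : Type*} [Field K] {r n : ℕ} (v : AddValuation K (WithTop ℤ))
    (A B : Matrix (Fin r) (Fin n) K)
    (h : ∀ S : {S : Finset (Fin n) // S.card = r}, 0 ≤ v ((colSub A S).det * (colSub B S).det))
    (s : Fin r → Fin n) (hA : A.submatrix id s = 1) (hB : B.submatrix id s = 1)
    (k : ℕ) (f : Fin k → Fin r) (g : Fin k → Fin n) :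
    0 ≤ v ((A.submatrix f g).det * (B.submatrix f g).det) := by
  by_cases hf : Function.Injective f
  · rw [minor_eq A s hA f hf g, minor_eq B s hB f hf g]
    exact cols_fun v A B h _
  · have : (A.submatrix f g).det = 0 := by
      simp only [Function.Injective, not_forall] at hf
      obtain ⟨i, j, hij, hne⟩ := hf
      exact Matrix.det_zero_of_row_eq hne (by funext k; simp [hij])
    rw [this, zero_mul, v.map_zero]
    exact le_top

theorem colSub_mul {K : Type*} [Field K] {r n : ℕ} (C : Matrix (Fin r) (Fin r) K)
    (U : Matrix (Fin r) (Fin n) K) (S : {S : Finset (Fin n) // S.card = r}) :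
    colSub (C * U) S = C * colSub U S := by
  ext i j
  simp [colSub, Matrix.mul_apply]

theorem colSub_scale_det {K : Type*} [Field K] {r n : ℕ} (p : Fin r → K) (q : Fin n → K)
    (A : Matrix (Fin r) (Fin n) K) (S : {S : Finset (Fin n) // S.card = r}) :
    (colSub (Matrix.of fun i j => p i * (q j * A i j)) S).det =
      (∏ i, p i) * ((∏ j, q (S.1.orderIsoOfFin S.2 j)) * (colSub A S).det) := by
  rw [← Matrix.det_mul_row, ← Matrix.det_mul_column]
  rfl

/-- If U, V ∈ F(ε)^{r×n} have full row rank and lim_{ε→0} det(U_S)·det(V_S) exists for every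
size-r subset S, then there are Ũ, Ṽ ∈ F(ε)^{r×n} such that all the individual limits
lim_{ε→0} det(Ũ_S), lim_{ε→0} det(Ṽ_S) exist and their product equals
lim_{ε→0} det(U_S)·det(V_S) for every S. -/
theorem split_limits_of_products {F : Type*} [Field F] {r n : ℕ}
    (U V : Matrix (Fin r) (Fin n) (RatFunc F)) (hU : U.rank = r) (hV : V.rank = r)
    (hlim : ∀ S : {S : Finset (Fin n) // S.card = r},
      rfHasLim ((colSub U S).det * (colSub V S).det)) :
    ∃ Ut Vt : Matrix (Fin r) (Fin n) (RatFunc F),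
      ∀ S : {S : Finset (Fin n) // S.card = r},
        rfHasLim (colSub Ut S).det ∧ rfHasLim (colSub Vt S).det ∧
        rfLim ((colSub U S).det * (colSub V S).det) =
          rfLim (colSub Ut S).det * rfLim (colSub Vt S).det := by
  set v := rfAddVal F with hv
  rcases Nat.eq_zero_or_pos r with rfl | hr
  · refine ⟨U, V, fun S => ?_⟩
    have h1 : rfHasLim (1 : RatFunc F) := by rw [rfHasLim, rfval_one]
    simp only [Matrix.det_fin_zero]
    exact ⟨h1, h1, rfLim_mul h1 h1⟩
  by_cases hex : ∃ S0 : {S : Finset (Fin n) // S.card = r},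
      rfval ((colSub U S0).det * (colSub V S0).det) = 0
  swap
  · push Not at hex
    refine ⟨0, 0, fun S => ?_⟩
    have hz : (colSub (0 : Matrix (Fin r) (Fin n) (RatFunc F)) S).det = 0 := by
      have : colSub (0 : Matrix (Fin r) (Fin n) (RatFunc F)) S = 0 := rfl
      have hne : Nonempty (Fin r) := ⟨⟨0, hr⟩⟩
      rw [this, Matrix.det_zero]
    have h0 : rfHasLim (0 : RatFunc F) := by rw [rfHasLim, rfval_zero]; exact le_top
    rw [hz]
    refine ⟨h0, h0, ?_⟩
    rw [rfLim_eq_zero (lt_of_le_of_ne (hlim S) (hex S).symm), ← rfLim_mul h0 h0, mul_zero,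
      rfLim_eq_zero (by rw [rfval_zero]; exact WithTop.coe_lt_top 0)]
  obtain ⟨S0, hS0⟩ := hex
  set dU := (colSub U S0).det with hdU
  set dV := (colSub V S0).det with hdV
  have hne : dU * dV ≠ 0 := by
    intro h
    rw [h, rfval_zero] at hS0
    exact absurd hS0 (WithTop.coe_ne_top (a := (0 : ℤ))).symm
  have hUne : dU ≠ 0 := left_ne_zero_of_mul hne
  have hVne : dV ≠ 0 := right_ne_zero_of_mul hne
  set A := (colSub U S0)⁻¹ * U with hA
  set B := (colSub V S0)⁻¹ * V with hB
  have dA : ∀ S, (colSub U S).det = dU * (colSub A S).det := by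
    intro S
    rw [hA, colSub_mul, Matrix.det_mul, Matrix.det_nonsing_inv, Ring.inverse_eq_inv',
      mul_inv_cancel_left₀ hUne]
  have dB : ∀ S, (colSub V S).det = dV * (colSub B S).det := by
    intro S
    rw [hB, colSub_mul, Matrix.det_mul, Matrix.det_nonsing_inv, Ring.inverse_eq_inv',
      mul_inv_cancel_left₀ hVne]
  have hprod : ∀ S, (colSub U S).det * (colSub V S).det =
      (dU * dV) * ((colSub A S).det * (colSub B S).det) := by
    intro S
    rw [dA, dB]
    ring
  have hmin : ∀ S, 0 ≤ v ((colSub A S).det * (colSub B S).det) := by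
    intro S
    have := hlim S
    rw [rfHasLim, hprod, rfval_mul, hS0, zero_add] at this
    exact this
  have hA1 : colSub A S0 = 1 := by
    rw [hA, colSub_mul, Matrix.nonsing_inv_mul _ (isUnit_iff_ne_zero.2 hUne)]
  have hB1 : colSub B S0 = 1 := by
    rw [hB, colSub_mul, Matrix.nonsing_inv_mul _ (isUnit_iff_ne_zero.2 hVne)]
  obtain ⟨x, y, hxy⟩ := exists_weights v A B (minors_nonneg v A B hmin _ hA1 hB1)
  have hXne : (RatFunc.X : RatFunc F) ≠ 0 := RatFunc.X_ne_zero
  let κ : Fin r → RatFunc F := Function.update 1 ⟨0, hr⟩ (dU * dV)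
  have hκ : ∏ i, κ i = dU * dV := by
    simp [κ, Finset.prod_update_of_mem]
  have hκv : ∀ i, rfval (κ i) = 0 := by
    intro i
    by_cases hi : i = ⟨0, hr⟩
    · subst hi
      simp [κ, hS0]
    · simp [κ, hi, rfval_one]
  refine ⟨Matrix.of fun i j => RatFunc.X ^ (x i) * (RatFunc.X ^ (-y j) * A i j),
    Matrix.of fun i j => (κ i * RatFunc.X ^ (-x i)) * (RatFunc.X ^ (y j) * B i j), fun S => ?_⟩
  have shift : ∀ (a b : ℤ) (w : WithTop ℤ), ((-b - a : ℤ) : WithTop ℤ) ≤ w →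
      (0 : WithTop ℤ) ≤ (a : WithTop ℤ) + ((b : WithTop ℤ) + w) := by
    intro a b w h
    rcases w with _ | w
    · exact le_top
    · have h' := WithTop.coe_le_coe.1 h
      apply WithTop.coe_le_coe.2
      change (0 : ℤ) ≤ a + (b + w)
      omega
  have l1 : rfHasLim (colSub (Matrix.of fun i j =>
      (RatFunc.X : RatFunc F) ^ (x i) * (RatFunc.X ^ (-y j) * A i j)) S).det := by
    apply val_det_nonneg v
    intro i j
    simp only [colSub, Matrix.submatrix_apply, Matrix.of_apply, id, hv, rfAddVal_apply]
    rw [rfval_mul, rfval_mul, rfval_X_zpow, rfval_X_zpow]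
    apply shift
    rw [neg_neg]
    exact (hxy _ _).1
  have l2 : rfHasLim (colSub (Matrix.of fun i j =>
      (κ i * (RatFunc.X : RatFunc F) ^ (-x i)) * (RatFunc.X ^ (y j) * B i j)) S).det := by
    apply val_det_nonneg v
    intro i j
    simp only [colSub, Matrix.submatrix_apply, Matrix.of_apply, id, hv, rfAddVal_apply]
    rw [rfval_mul, rfval_mul, rfval_mul, rfval_X_zpow, rfval_X_zpow, hκv, zero_add]
    apply shift
    rw [show ∀ a b : ℤ, -a - -b = b - a by intros; ring]
    exact (hxy _ _).2
  refine ⟨l1, l2, ?_⟩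
  rw [← rfLim_mul l1 l2, colSub_scale_det, colSub_scale_det, hprod, Finset.prod_mul_distrib, hκ]
  congr 1
  have e1 : (∏ i, (RatFunc.X : RatFunc F) ^ x i) * ∏ i, (RatFunc.X : RatFunc F) ^ (-x i) = 1 := by
    rw [← Finset.prod_mul_distrib]
    apply Finset.prod_eq_one
    intro i _
    rw [← zpow_add₀ hXne, add_neg_cancel, zpow_zero]
  have e2 : (∏ j, (RatFunc.X : RatFunc F) ^ (-y (S.1.orderIsoOfFin S.2 j))) *
      ∏ j, (RatFunc.X : RatFunc F) ^ (y (S.1.orderIsoOfFin S.2 j)) = 1 := by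
    rw [← Finset.prod_mul_distrib]
    apply Finset.prod_eq_one
    intro i _
    rw [← zpow_add₀ hXne, neg_add_cancel, zpow_zero]
  linear_combination (-(dU * dV) * ((colSub A S).det * (colSub B S).det)) * (e1 *
    ((∏ j, (RatFunc.X : RatFunc F) ^ (-y (S.1.orderIsoOfFin S.2 j))) *
      ∏ j, (RatFunc.X : RatFunc F) ^ (y (S.1.orderIsoOfFin S.2 j))) + e2)
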